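/- Let F : ℝ^ℤ → ℝ depend only on coordinates u(0),…,u(ℓ-1), be integrable with respect to μ_λ = ⊗_{j∈ℤ} p_λ for every λ ∈ ℝ, and assume E_λ[F] = 0 for all λ ∈ ℝ. Then E_λ[F · φ(∑_{i=0}^{ℓ-1} u(i))] = 0 for every λ and every measurable φ for which the expectation is well defined. -/

import Mathlib

open MeasureTheory

/-- Integrability of `g` against the positive part of `w`. -/
lemma aux_int {Ω : Type*} [MeasurableSpace Ω] (ν : Measure Ω) (w : Ω → ℝ) (hw : Measurable w)
    (g : Ω → ℝ) (hg : Measurable g) (hi : Integrable (fun x => w x * g x) ν) :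
    Integrable (fun x => max (w x) 0 * g x) ν := by
  refine hi.mono (by fun_prop) (Filter.Eventually.of_forall fun x => ?_)
  rw [norm_mul, norm_mul]
  gcongr
  rw [Real.norm_eq_abs, Real.norm_eq_abs, abs_of_nonneg (le_max_right _ _)]
  exact max_le (le_abs_self _) (abs_nonneg _)

lemma aux_wd {Ω : Type*} [MeasurableSpace Ω] (ν : Measure Ω) (w : Ω → ℝ) (hw : Measurable w)
    (g : Ω → ℝ) :
    ∫ x, g x ∂(ν.withDensity fun x => ENNReal.ofReal (w x)) = ∫ x, max (w x) 0 * g x ∂ν := by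
  rw [integral_withDensity_eq_integral_toReal_smul (by fun_prop)
    (Filter.Eventually.of_forall fun x => ENNReal.ofReal_lt_top)]
  simp [ENNReal.toReal_ofReal']

lemma aux_wd_int {Ω : Type*} [MeasurableSpace Ω] (ν : Measure Ω) (w : Ω → ℝ) (hw : Measurable w)
    (g : Ω → ℝ) (hg : Measurable g) (hi : Integrable (fun x => w x * g x) ν) :
    Integrable g (ν.withDensity fun x => ENNReal.ofReal (w x)) := by
  rw [integrable_withDensity_iff_integrable_smul' (by fun_prop)
    (Filter.Eventually.of_forall fun x => ENNReal.ofReal_lt_top)]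
  simpa [ENNReal.toReal_ofReal'] using aux_int ν w hw g hg hi

lemma aux_sub {Ω : Type*} [MeasurableSpace Ω] (ν : Measure Ω) (w : Ω → ℝ) (hw : Measurable w)
    (g : Ω → ℝ) (hg : Measurable g) (hi : Integrable (fun x => w x * g x) ν) :
    ∫ x, w x * g x ∂ν = ∫ x, g x ∂(ν.withDensity fun x => ENNReal.ofReal (w x))
      - ∫ x, g x ∂(ν.withDensity fun x => ENNReal.ofReal (- w x)) := by
  rw [aux_wd ν w hw, aux_wd ν (fun x => - w x) hw.neg, ← integral_sub (aux_int ν w hw g hg hi)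
    (aux_int ν (fun x => - w x) hw.neg g hg (by simpa using hi.neg))]
  congr 1
  ext x
  rw [← sub_mul, max_zero_sub_max_neg_zero_eq_self]

open ProbabilityTheory in
/-- Uniqueness of the two-sided Laplace transform for the signed law of `S` with density `w`. -/
lemma aux_main {Ω : Type*} [MeasurableSpace Ω] (ν : Measure Ω) (w : Ω → ℝ) (hw : Measurable w)
    (S : Ω → ℝ) (hS : Measurable S)
    (hi : ∀ t : ℝ, Integrable (fun x => w x * Real.exp (t * S x)) ν)
    (h0 : ∀ t : ℝ, ∫ x, w x * Real.exp (t * S x) ∂ν = 0)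
    (φ : ℝ → ℝ) (hφ : Measurable φ) (hφi : Integrable (fun x => w x * φ (S x)) ν) :
    ∫ x, w x * φ (S x) ∂ν = 0 := by
  have hi' : ∀ t : ℝ, Integrable (fun x => (-w x) * Real.exp (t * S x)) ν := fun t => by
    simpa using (hi t).neg
  have e1 : ∀ t, Integrable (fun x => Real.exp (t * S x))
      (ν.withDensity fun x => ENNReal.ofReal (w x)) := fun t =>
    aux_wd_int ν w hw _ (by fun_prop) (hi t)
  have e2 : ∀ t, Integrable (fun x => Real.exp (t * S x))
      (ν.withDensity fun x => ENNReal.ofReal (- w x)) := fun t =>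
    aux_wd_int ν (fun x => - w x) hw.neg _ (by fun_prop) (hi' t)
  have e3 : ∀ t, ∫ x, Real.exp (t * S x) ∂(ν.withDensity fun x => ENNReal.ofReal (w x))
      = ∫ x, Real.exp (t * S x) ∂(ν.withDensity fun x => ENNReal.ofReal (- w x)) := fun t => by
    have := aux_sub ν w hw _ (by fun_prop) (hi t)
    rw [h0 t] at this
    linarith
  rw [aux_sub ν w hw _ (by fun_prop) hφi]
  generalize (ν.withDensity fun x => ENNReal.ofReal (w x)) = μ at *
  generalize (ν.withDensity fun x => ENNReal.ofReal (- w x)) = μ' at *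
  have : IsFiniteMeasure μ := by
    have := e1 0
    simp only [zero_mul, Real.exp_zero] at this
    exact (integrable_const_iff_isFiniteMeasure one_ne_zero).1 this
  have : IsFiniteMeasure μ' := by
    have := e2 0
    simp only [zero_mul, Real.exp_zero] at this
    exact (integrable_const_iff_isFiniteMeasure one_ne_zero).1 this
  have hz : μ = 0 ↔ μ' = 0 := by
    have := e3 0
    simp only [zero_mul, Real.exp_zero, integral_const, smul_eq_mul, mul_one] at this
    rw [← Measure.measure_univ_eq_zero, ← Measure.measure_univ_eq_zero,
      ← measureReal_eq_zero_iff, ← measureReal_eq_zero_iff, this]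
  have hset : integrableExpSet S μ = Set.univ := Set.eq_univ_of_forall fun t => e1 t
  have hc : complexMGF S μ = complexMGF S μ' := by
    have := eqOn_complexMGF_of_mgf' (X := S) (Y := S) (μ := μ) (μ' := μ')
      (funext fun t => e3 t) hz
    ext z
    exact this (by simp [hset])
  have hm := Measure.ext_of_complexMGF_eq hS.aemeasurable hS.aemeasurable hc
  rw [← integral_map hS.aemeasurable hφ.aestronglyMeasurable,
    ← integral_map hS.aemeasurable hφ.aestronglyMeasurable, hm, sub_self]



theorem orthogonality_to_functions_of_the_sum
    (ℓ : ℕ)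
    (V : ℝ → ℝ) (hVmeas : Measurable V)
    (hint : ∀ l : ℝ, Integrable (fun u => Real.exp (l * u - V u)))
    (Z : ℝ → ℝ) (hZ : ∀ l, Z l = ∫ u, Real.exp (l * u - V u))
    (p : ℝ → ℝ → ℝ) (hp : ∀ l u, p l u = Real.exp (l * u - V u) / Z l)
    (F : (ℤ → ℝ) → ℝ) (G : (Fin ℓ → ℝ) → ℝ) (hGmeas : Measurable G)
    (hFG : ∀ u : ℤ → ℝ, F u = G (fun i => u (i : ℤ)))
    (hFint : ∀ l : ℝ,
      Integrable (fun x : Fin ℓ → ℝ => G x * ∏ i, p l (x i)) (Measure.pi fun _ => volume))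
    (hzero : ∀ l : ℝ,
      ∫ x : Fin ℓ → ℝ, G x * ∏ i, p l (x i) ∂(Measure.pi fun _ => volume) = 0)
    (l : ℝ) (φ : ℝ → ℝ) (hφ : Measurable φ)
    (hφint : Integrable (fun x : Fin ℓ → ℝ => G x * φ (∑ i, x i) * ∏ i, p l (x i))
      (Measure.pi fun _ => volume)) :
    ∫ x : Fin ℓ → ℝ, G x * φ (∑ i, x i) * ∏ i, p l (x i) ∂(Measure.pi fun _ => volume) = 0 := by

  have hZpos : ∀ l, 0 < Z l := fun l => by
    rw [hZ]; exact integral_exp_pos (hint l)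
  have hpm : ∀ l, Measurable (p l) := fun l => by
    rw [show p l = fun u => Real.exp (l * u - V u) / Z l from funext (hp l)]
    fun_prop
  have key : ∀ (t : ℝ) (x : Fin ℓ → ℝ), (G x * ∏ i, p l (x i)) * Real.exp (t * ∑ i, x i)
      = (Z (l + t) / Z l) ^ ℓ * (G x * ∏ i, p (l + t) (x i)) := by
    intro t x
    have h1 : ∀ u, p l u * Real.exp (t * u) = (Z (l + t) / Z l) * p (l + t) u := by
      intro u
      have a := (hZpos l).ne'
      have b := (hZpos (l + t)).ne'
      rw [hp, hp, show (l + t) * u - V u = (l * u - V u) + t * u by ring, Real.exp_add]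
      field_simp
    have h2 : (∏ i, p l (x i)) * Real.exp (t * ∑ i, x i)
        = (Z (l + t) / Z l) ^ ℓ * ∏ i, p (l + t) (x i) := by
      rw [Finset.mul_sum, Real.exp_sum, ← Finset.prod_mul_distrib]
      simp only [h1]
      rw [Finset.prod_mul_distrib, Finset.prod_const, Finset.card_univ, Fintype.card_fin]
    rw [mul_assoc, h2]
    ring
  have hfin := aux_main (Measure.pi fun _ : Fin ℓ => (volume : Measure ℝ))
    (fun x => G x * ∏ i, p l (x i))
    (hGmeas.mul (Finset.measurable_prod _ fun i _ => (hpm l).comp (measurable_pi_apply i)))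
    (fun x => ∑ i, x i) (by fun_prop)
    (fun t => by simp only [key]; exact (hFint (l + t)).const_mul _)
    (fun t => by simp only [key]; rw [integral_const_mul, hzero, mul_zero])
    φ hφ (by simpa only [mul_right_comm] using hφint)
  simpa only [mul_right_comm] using hfin
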